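/- Let p be a prime and let G be a Miller p-group with |[G,G]| > 2, and let p^e be the exponent of [G,G]. Then the subgroup of [G,G] generated by {x^{p^{e-1}} : x ∈ [G,G]} is not cyclic; that is, [G,G] has at least two cyclic factors of maximal order in its decomposition into cyclic groups. -/

import Mathlib

/-- A Miller group: a finite non-abelian group whose full automorphism group is abelian. -/
def IsMiller (G : Type*) [Group G] : Prop :=
  Finite G ∧ (∃ a b : G, a * b ≠ b * a) ∧ ∀ φ ψ : MulAut G, φ * ψ = ψ * φ

section

open Subgroup
open scoped commutatorElement IsMulCommutative

theorem MonoidHom.exists_pow_eq_of_finite {A : Type*} [CommGroup A] [Finite A] (χ : A →* ℂˣ)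
    (n : ℕ) (h : ∀ x, x ^ n = 1 → χ x = 1) : ∃ ψ : A →* ℂˣ, ∀ x, ψ x ^ n = χ x := by
  have : NeZero (Monoid.exponent A) := ⟨Monoid.exponent_ne_zero_of_finite⟩
  let f := (powMonoidHom n : A →* A)
  have hf : f.ker = f.rangeRestrict.ker := (MonoidHom.ker_rangeRestrict f).symm
  let g : f.range →* ℂˣ := f.rangeRestrict.liftOfSurjective f.rangeRestrict_surjective
    ⟨χ, by rw [← hf]; exact fun x hx => h x hx⟩
  obtain ⟨ψ, hψ⟩ := MonoidHom.domRestrict_surjective ℂ f.range g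
  refine ⟨ψ, fun x => ?_⟩
  have h1 : g (f.rangeRestrict x) = χ x := MonoidHom.liftOfRightInverse_comp_apply _ _ _ _ x
  rw [← h1, ← hψ, ← map_pow]
  rfl

namespace IsMiller

variable {G : Type*} [Group G]

theorem commutatorElement_mem_center (hG : IsMiller G) (a b : G) : ⁅a, b⁆ ∈ center G := by
  rw [mem_center_iff]
  intro g
  have h := hG.2.2 (MulAut.conj a) (MulAut.conj b)
  rw [← map_mul, ← map_mul] at h
  have h2 := DFunLike.congr_fun h (a⁻¹ * b⁻¹ * g * b * a)
  simp only [MulAut.conj_apply, mul_inv_rev] at h2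
  rw [commutatorElement_def]
  have h3 : g * (a * b * a⁻¹ * b⁻¹) = b * a * (a⁻¹ * b⁻¹ * g * b * a) * (a⁻¹ * b⁻¹) *
    (a * b * a⁻¹ * b⁻¹) := by group
  rw [h3, ← h2]
  group

theorem apply_mul_inv_mem_center (hG : IsMiller G) (φ : MulAut G) (x : G) :
    φ x * x⁻¹ ∈ center G := by
  rw [mem_center_iff]
  intro g
  have h2 (y : G) : φ x * y * (φ x)⁻¹ = x * y * x⁻¹ := by
    simpa [MulAut.conj_apply] using DFunLike.congr_fun (hG.2.2 φ (MulAut.conj x)) (φ⁻¹ y)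
  have h3 : g * (φ x * x⁻¹) = x * (x⁻¹ * g * x) * x⁻¹ * (φ x * x⁻¹) := by group
  rw [h3, ← h2]
  group

end IsMiller

section ClassTwo

variable {G : Type*} [Group G]

theorem commutatorElement_mul_right_of_central (hZ : ∀ a b : G, ⁅a, b⁆ ∈ center G) (u x y : G) :
    ⁅u, x * y⁆ = ⁅u, x⁆ * ⁅u, y⁆ := by
  have h := mem_center_iff.1 (hZ u y) (u * x * u⁻¹)
  have : ⁅u, x * y⁆ = u * x * u⁻¹ * ⁅u, y⁆ * x⁻¹ := by simp only [commutatorElement_def]; group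
  rw [this, mul_assoc _ _ x⁻¹, ← mem_center_iff.1 (hZ u y) x⁻¹]
  simp only [commutatorElement_def, mul_assoc]

/-- In a group of class at most two, `x ↦ ⁅u, x⁆` as a homomorphism to the center. -/
def commutatorHom (hZ : ∀ a b : G, ⁅a, b⁆ ∈ center G) (u : G) : G →* center G :=
  MonoidHom.mk' (fun x => ⟨⁅u, x⁆, hZ u x⟩)
    fun x y => Subtype.ext (commutatorElement_mul_right_of_central hZ u x y)

theorem commutatorElement_pow_right_of_central (hZ : ∀ a b : G, ⁅a, b⁆ ∈ center G) (u x : G)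
    (n : ℕ) : ⁅u, x ^ n⁆ = ⁅u, x⁆ ^ n :=
  congrArg Subtype.val (map_pow (commutatorHom hZ u) x n)

theorem commutatorElement_mul_left_of_central (hZ : ∀ a b : G, ⁅a, b⁆ ∈ center G) (u v x : G) :
    ⁅u * v, x⁆ = ⁅u, x⁆ * ⁅v, x⁆ := by
  rw [← commutatorElement_inv, commutatorElement_mul_right_of_central hZ, mul_inv_rev,
    commutatorElement_inv, commutatorElement_inv, mem_center_iff.1 (hZ u x)]

theorem commutatorElement_pow_left_of_central (hZ : ∀ a b : G, ⁅a, b⁆ ∈ center G) (u x : G)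
    (n : ℕ) : ⁅u ^ n, x⁆ = ⁅u, x⁆ ^ n := by
  rw [← commutatorElement_inv, commutatorElement_pow_right_of_central hZ, ← inv_pow,
    commutatorElement_inv]

theorem commutatorElement_eq_one_of_mem_center {z : G} (hz : z ∈ center G) (x : G) :
    ⁅z, x⁆ = 1 := by
  rw [commutatorElement_eq_one_iff_mul_comm, mem_center_iff.1 hz x]

theorem commutator_le_center (hZ : ∀ a b : G, ⁅a, b⁆ ∈ center G) : commutator G ≤ center G :=
  commutator_le.2 fun a _ b _ => hZ a b

theorem commutatorElement_mem_commutator (a b : G) : ⁅a, b⁆ ∈ commutator G :=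
  commutator_mem_commutator (mem_top a) (mem_top b)

theorem mul_pow_of_central (hZ : ∀ a b : G, ⁅a, b⁆ ∈ center G) (a b : G) (n : ℕ) :
    (a * b) ^ n = a ^ n * b ^ n * ⁅b, a⁆ ^ n.choose 2 := by
  induction n with
  | zero => simp
  | succ n ih =>
    have hc := fun m : ℕ => mem_center_iff.1 ((center G).pow_mem (hZ b a) m)
    have h2 : b ^ n * a = ⁅b, a⁆ ^ n * (a * b ^ n) := by
      rw [← commutatorElement_pow_left_of_central hZ, commutatorElement_def]; group
    calc (a * b) ^ (n + 1) = a ^ n * (b ^ n * (⁅b, a⁆ ^ n.choose 2 * (a * b))) := by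
          rw [pow_succ, ih]; simp only [mul_assoc]
      _ = a ^ n * (b ^ n * a) * b * ⁅b, a⁆ ^ n.choose 2 := by
          rw [← hc]; simp only [mul_assoc]
      _ = a ^ (n + 1) * b ^ (n + 1) * (⁅b, a⁆ ^ n * ⁅b, a⁆ ^ n.choose 2) := by
          rw [h2, ← hc]
          simp only [mul_assoc, pow_succ]
          rw [← mul_assoc b, hc n b, mul_assoc]
      _ = _ := by
          rw [← pow_add, Nat.choose_succ_succ' n 1, Nat.choose_one_right]

end ClassTwo

theorem pow_sq_eq_pow_sq_of_modEq {M : Type*} [Monoid M] {w : M} {p a b : ℕ}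
    (h₁ : w ^ (2 * p) = 1) (h₂ : w ^ p ^ 2 = 1) (hab : a ≡ b [MOD p]) :
    w ^ a ^ 2 = w ^ b ^ 2 := by
  wlog hle : a ≤ b generalizing a b
  · exact (this hab.symm (le_of_not_ge hle)).symm
  obtain ⟨t, ht⟩ := (Nat.modEq_iff_dvd' hle).1 hab
  obtain rfl : b = a + p * t := by omega
  have : (a + p * t) ^ 2 = a ^ 2 + 2 * p * (a * t) + p ^ 2 * t ^ 2 := by ring
  rw [this, pow_add, pow_add, pow_mul w (2 * p), pow_mul w (p ^ 2), h₁, h₂]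
  simp

section Construction

variable {G : Type*} [Group G] {p q j : ℕ} {u y : G}

theorem exists_adapted_character [Finite G] (hp : p.Prime) (hZ : ∀ a b : G, ⁅a, b⁆ ∈ center G)
    (hexp : ∀ c ∈ commutator G, (c ^ q) ^ p = 1)
    (hcyc : ∀ c ∈ commutator G, ∀ d ∈ commutator G, c ^ q ≠ 1 → ∃ s : ℕ, d ^ q = (c ^ q) ^ s)
    (hne : ⁅u, y⁆ ^ q ≠ 1)
    (hker : ∀ x, x ^ p ^ j ∈ commutator G → ⁅u, x⁆ ^ q = 1) :
    ∃ (ψ : G →* ℂˣ) (ζ : ℂˣ) (n : G → ℕ), IsPrimitiveRoot ζ (p ^ (j + 1)) ∧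
      (∀ x, ψ x = ζ ^ n x) ∧ ∀ x, ⁅u, x⁆ ^ q = (⁅u, y⁆ ^ q) ^ n x := by
  let β : G →* center G := (powMonoidHom q).comp (commutatorHom hZ u)
  have hβ (x : G) : (β x : G) = ⁅u, x⁆ ^ q := rfl
  have hβy : β y ≠ 1 := fun h => hne (by rw [← hβ, h]; rfl)
  have hβp (x : G) : β x ^ p = 1 :=
    Subtype.ext (hexp _ (commutatorElement_mem_commutator u x))
  have : NeZero (Monoid.exponent (center G)) := ⟨Monoid.exponent_ne_zero_of_finite⟩
  obtain ⟨φ, hφ⟩ := CommGroup.exists_apply_ne_one_of_hasEnoughRootsOfUnity (center G) ℂ hβy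
  have hφp (x : G) : φ (β x) ^ p = 1 := by rw [← map_pow, hβp, map_one]
  obtain ⟨ψ', hψ'⟩ := MonoidHom.exists_pow_eq_of_finite
    (Abelianization.lift (φ.comp β)) (p ^ j) (fun a ha => by
      induction a using QuotientGroup.induction_on with
      | H x =>
        have hx : x ^ p ^ j ∈ commutator G := by
          rw [← Abelianization.ker_of]
          exact (map_pow Abelianization.of x _).trans ha
        have : β x = 1 := Subtype.ext (hker x hx)
        change φ (β x) = 1
        rw [this, map_one])
  let ψ : G →* ℂˣ := ψ'.comp Abelianization.of
  have hψ (x : G) : ψ x ^ p ^ j = φ (β x) := hψ' (Abelianization.of x)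
  have hψp (x : G) : ψ x ^ p ^ (j + 1) = 1 := by rw [pow_succ, pow_mul, hψ, hφp]
  have := Fact.mk hp
  have hζ : IsPrimitiveRoot (ψ y) (p ^ (j + 1)) := by
    rw [IsPrimitiveRoot.iff_orderOf]
    exact orderOf_eq_prime_pow (by rwa [hψ]) (hψp y)
  have hn (x : G) : ∃ n : ℕ, ψ x = ψ y ^ n := by
    obtain ⟨i, -, hi⟩ := (IsPrimitiveRoot.coe_units_iff.2 hζ).eq_pow_of_pow_eq_one
      (ξ := (ψ x : ℂ)) (by rw [← Units.val_pow_eq_pow_val, hψp, Units.val_one])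
    exact ⟨i, by ext; simpa using hi.symm⟩
  choose n hn using hn
  refine ⟨ψ, ψ y, n, hζ, hn, fun x => ?_⟩
  obtain ⟨s, hs⟩ := hcyc _ (commutatorElement_mem_commutator u y) _
    (commutatorElement_mem_commutator u x) hne
  have hs' : β x = β y ^ s := Subtype.ext hs
  have hmod : s ≡ n x [MOD p] := by
    have h1 : orderOf (φ (β y)) = p := orderOf_eq_prime (hφp y) hφ
    rw [← h1, ← pow_eq_pow_iff_modEq, ← map_pow, ← hs', ← hψ, ← hψ, hn x, pow_right_comm]
  rw [hs]
  exact pow_eq_pow_of_modEq hmod (hexp _ (commutatorElement_mem_commutator u y))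

theorem exists_mulAut_not_central [Finite G] (hp : p.Prime) (hZ : ∀ a b : G, ⁅a, b⁆ ∈ center G)
    (hexp : ∀ c ∈ commutator G, (c ^ q) ^ p = 1)
    (hcyc : ∀ c ∈ commutator G, ∀ d ∈ commutator G, c ^ q ≠ 1 → ∃ s : ℕ, d ^ q = (c ^ q) ^ s)
    (hsqrt : ∃ w ∈ commutator G, w ^ 2 = ⁅u, y⁆ ^ q ∧ w ^ p ^ 2 = 1)
    (hne : ⁅u, y⁆ ^ q ≠ 1) (hu : (u ^ q) ^ p ^ (j + 1) = 1)
    (hker : ∀ x, x ^ p ^ j ∈ commutator G → ⁅u, x⁆ ^ q = 1) :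
    ∃ φ : MulAut G, φ y * y⁻¹ ∉ center G := by
  obtain ⟨ψ, ζ, n, hζ, hψ, hn⟩ := exists_adapted_character hp hZ hexp hcyc hne hker
  obtain ⟨w, hwG, hw, hwp⟩ := hsqrt
  set z := ⁅u, y⁆ ^ q
  set v := u ^ q with hv
  have hzp : z ^ p = 1 := hexp _ (commutatorElement_mem_commutator u y)
  have hzo : orderOf z = p := by
    have := Fact.mk hp
    exact orderOf_eq_prime hzp hne
  have hw2p : w ^ (2 * p) = 1 := by rw [pow_mul, hw, hzp]
  have hwc : w ∈ center G := commutator_le_center hZ hwG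
  have hmod (a b : ℕ) (h : ζ ^ a = ζ ^ b) : a ≡ b [MOD p ^ (j + 1)] := by
    rwa [hζ.eq_orderOf, ← pow_eq_pow_iff_modEq]
  have hvpow (a b : ℕ) (h : ζ ^ a = ζ ^ b) : v ^ a = v ^ b :=
    pow_eq_pow_of_modEq (hmod a b h) hu
  have hwpow (a b : ℕ) (h : ζ ^ a = ζ ^ b) : w ^ a ^ 2 = w ^ b ^ 2 :=
    pow_sq_eq_pow_sq_of_modEq hw2p hwp ((hmod a b h).of_dvd (dvd_pow_self p j.succ_ne_zero))
  have hcomm (a : ℕ) (x : G) : ⁅v ^ a, x⁆ = z ^ (n x * a) := by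
    rw [hv, ← pow_mul, commutatorElement_pow_left_of_central hZ, pow_mul, hn, pow_mul]
  have hwcomm (a : ℕ) := mem_center_iff.1 ((center G).pow_mem hwc a)
  let f : G →* G := MonoidHom.mk' (fun x => x * v ^ n x * w ^ n x ^ 2) fun x x' => by
    have hadd : ζ ^ n (x * x') = ζ ^ (n x + n x') := by
      rw [← hψ, map_mul, hψ, hψ, pow_add]
    have hswap : v ^ n x * x' = x' * v ^ n x * w ^ (2 * (n x' * n x)) := by
      rw [pow_mul w, hw, ← hcomm, mem_center_iff.1 (hZ _ _), commutatorElement_def]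
      group
    change x * x' * v ^ n (x * x') * w ^ n (x * x') ^ 2 = _
    calc x * x' * v ^ n (x * x') * w ^ n (x * x') ^ 2
        = x * x' * v ^ (n x + n x') * w ^ (n x + n x') ^ 2 := by
          rw [hvpow _ _ hadd, hwpow _ _ hadd]
      _ = x * (x' * v ^ n x * w ^ (2 * (n x' * n x))) * w ^ n x ^ 2 * v ^ n x' *
            w ^ n x' ^ 2 := by
          have : (n x + n x') ^ 2 = 2 * (n x' * n x) + n x ^ 2 + n x' ^ 2 := by ring
          rw [this, pow_add w, pow_add w, pow_add v]
          simp only [mul_assoc]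
          rw [← mul_assoc (w ^ n x ^ 2) (v ^ n x'), ← hwcomm (n x ^ 2) (v ^ n x')]
          simp only [mul_assoc]
          rw [← mul_assoc (w ^ (2 * (n x' * n x))) (v ^ n x'),
            ← hwcomm (2 * (n x' * n x)) (v ^ n x')]
          simp only [mul_assoc]
      _ = x * (v ^ n x * x') * w ^ n x ^ 2 * v ^ n x' * w ^ n x' ^ 2 := by rw [← hswap]
      _ = (x * v ^ n x * w ^ n x ^ 2) * (x' * v ^ n x' * w ^ n x' ^ 2) := by
          simp only [mul_assoc]
          rw [← mul_assoc x' (w ^ n x ^ 2), hwcomm]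
          simp only [mul_assoc]
  have hf (x : G) : f x = x * v ^ n x * w ^ n x ^ 2 := rfl
  have hinj : Function.Injective f := by
    rw [injective_iff_map_eq_one]
    intro x hx
    have hψw : ψ w = 1 := Abelianization.commutator_subset_ker ψ hwG
    have hpu : p ∣ n u := by
      rw [← hzo, orderOf_dvd_iff_pow_eq_one, ← hn, commutatorElement_self, one_pow]
    have h1 : ζ ^ (n x * (1 + n u * q)) = 1 := by
      have := congrArg ψ hx
      rw [hf, map_mul, map_mul, map_pow ψ v, map_pow ψ w, hψw, one_pow, mul_one, hv, map_pow, map_one,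
        hψ x, hψ u] at this
      rw [← this, ← pow_mul, ← pow_mul, ← pow_add]
      ring_nf
    have h2 : (p ^ (j + 1)).Coprime (1 + n u * q) := by
      refine Nat.Coprime.pow_left _ ((Nat.Prime.coprime_iff_not_dvd hp).2 fun h => ?_)
      exact hp.one_lt.ne' (Nat.dvd_one.1 ((Nat.dvd_add_left (hpu.mul_right q)).1 h))
    have h3 : ζ ^ n x = ζ ^ 0 := by
      rw [pow_zero, hζ.pow_eq_one_iff_dvd]
      exact h2.dvd_of_dvd_mul_right ((hζ.pow_eq_one_iff_dvd _).1 h1)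
    rw [hf, hvpow _ _ h3, hwpow _ _ h3] at hx
    simpa using hx
  refine ⟨MulEquiv.ofBijective f (Finite.injective_iff_bijective.1 hinj), fun hc => ?_⟩
  have hny : z ^ n y = z := (hn y).symm
  have h1 : ⁅y * v ^ n y * w ^ n y ^ 2 * y⁻¹, y⁆ = 1 :=
    commutatorElement_eq_one_of_mem_center hc y
  rw [commutatorElement_mul_left_of_central hZ, commutatorElement_mul_left_of_central hZ,
    commutatorElement_mul_left_of_central hZ, hcomm, pow_mul, hny, hny,
    commutatorElement_eq_one_of_mem_center ((center G).pow_mem hwc _)] at h1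
  have h2 : ⁅y⁻¹, y⁆ = 1 := by simp [commutatorElement_def]
  rw [h2, commutatorElement_self] at h1
  exact hne (by simpa using h1)

theorem exists_adapted_element {e : ℕ} (hp : p.Prime) (hpG : IsPGroup p G)
    (hZ : ∀ a b : G, ⁅a, b⁆ ∈ center G) (he : 1 ≤ e) (he2 : p = 2 → 2 ≤ e)
    (hexp : ∀ c ∈ commutator G, c ^ p ^ e = 1)
    (hcyc : ∀ c ∈ commutator G, ∀ d ∈ commutator G, c ^ p ^ (e - 1) ≠ 1 →
      ∃ s : ℕ, d ^ p ^ (e - 1) = (c ^ p ^ (e - 1)) ^ s)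
    (hne : ∃ a b : G, ⁅a, b⁆ ^ p ^ (e - 1) ≠ 1) :
    ∃ (u y : G) (j : ℕ), ⁅u, y⁆ ^ p ^ (e - 1) ≠ 1 ∧ (u ^ p ^ (e - 1)) ^ p ^ (j + 1) = 1 ∧
      ∀ x, x ^ p ^ j ∈ commutator G → ⁅u, x⁆ ^ p ^ (e - 1) = 1 := by
  classical
  have hex : ∃ j : ℕ, ∃ u y : G,
      ⁅u, y⁆ ^ p ^ (e - 1) ≠ 1 ∧ (u ^ p ^ (e - 1)) ^ p ^ (j + 1) = 1 := by
    obtain ⟨a, b, hab⟩ := hne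
    obtain ⟨k, hk⟩ := hpG (a ^ p ^ (e - 1))
    exact ⟨k, a, b, hab, by rw [pow_succ, pow_mul, hk, one_pow]⟩
  set j := Nat.find hex
  have hmin {i : ℕ} (hi : i < j) {u y : G} (huy : ⁅u, y⁆ ^ p ^ (e - 1) ≠ 1) :
      (u ^ p ^ (e - 1)) ^ p ^ (i + 1) ≠ 1 := fun h => Nat.find_min hex hi ⟨u, y, huy, h⟩
  by_cases hcase : ∀ x : G, x ^ p ^ j ∈ commutator G → ∀ y : G, ⁅x, y⁆ ^ p ^ (e - 1) = 1
  · obtain ⟨u, y, huy, hu⟩ := Nat.find_spec hex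
    refine ⟨u, y, j, huy, hu, fun x hx => ?_⟩
    rw [← commutatorElement_inv, inv_pow, hcase x hx, inv_one]
  push Not at hcase
  obtain ⟨u, huG, y, huy⟩ := hcase
  have hq : p ^ e = p ^ (e - 1) * p := by rw [← pow_succ]; congr 1; omega
  refine ⟨u, y, j, huy, ?_, fun x hx => ?_⟩
  · rw [pow_succ, ← pow_mul, mul_left_comm, ← hq, pow_mul, hexp _ huG]
  by_contra hux
  have hej : e ≤ j := by
    by_contra! hlt
    apply huy
    have : u ^ p ^ (e - 1) ∈ center G := by
      have : p ^ (e - 1) = p ^ j * p ^ (e - 1 - j) := by rw [← pow_add]; congr 1; omega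
      rw [this, pow_mul]
      exact (center G).pow_mem (commutator_le_center hZ huG) _
    rw [← commutatorElement_pow_left_of_central hZ,
      commutatorElement_eq_one_of_mem_center this]
  have hj1 : j - 1 + 1 = j := by omega
  have hxu : ⁅x, u⁆ ^ p ^ (e - 1) ≠ 1 := by
    rwa [← commutatorElement_inv, inv_pow, inv_ne_one]
  have hx1 : (x ^ p ^ j) ^ p ^ (e - 1) ≠ 1 := by
    have := hmin (i := j - 1) (by omega) hxu
    rwa [hj1, pow_right_comm] at this
  obtain ⟨t, ht⟩ := hcyc _ hx _ ((commutator G).inv_mem huG) hx1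
  have hux' : ⁅u * x ^ t, x⁆ ^ p ^ (e - 1) ≠ 1 := by
    rwa [commutatorElement_mul_left_of_central hZ, commutatorElement_pow_left_of_central hZ,
      commutatorElement_self, one_pow, mul_one]
  refine hmin (i := j - 1) (by omega) hux' ?_
  rw [hj1, ← pow_mul, mul_pow_of_central hZ]
  have hchoose : p ^ e ∣ (p ^ (e - 1) * p ^ j).choose 2 := by
    rw [← pow_add, Nat.choose_two_right]
    rcases hp.eq_two_or_odd' with rfl | hodd
    · have := he2 rfl
      rw [Nat.dvd_div_iff_mul_dvd (Nat.even_mul_pred_self _).two_dvd, ← pow_succ']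
      exact Dvd.dvd.mul_right (pow_dvd_pow 2 (by omega)) _
    · have hdvd : p ^ e ∣ p ^ (e - 1 + j) := pow_dvd_pow p (by omega)
      refine Nat.Coprime.dvd_of_dvd_mul_left (k := p ^ e) (m := 2)
        (Nat.Coprime.pow_left _ hodd.coprime_two_right) ?_
      rw [Nat.mul_div_cancel' (Nat.even_mul_pred_self _).two_dvd]
      exact hdvd.mul_right _
  obtain ⟨m, hm⟩ := hchoose
  rw [hm, pow_mul ⁅x ^ t, u⁆, hexp _ (commutatorElement_mem_commutator _ _), one_pow, mul_one,
    mul_comm, pow_mul, ← pow_mul x, mul_comm t, pow_mul, pow_mul, ← ht, inv_pow, mul_inv_cancel]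

end Construction

/-- The central elements of `G` killed by the `n`-th power map. -/
def centerTorsion (G : Type*) [Group G] (n : ℕ) : Subgroup G :=
  (powMonoidHom n : center G →* center G).ker.map (center G).subtype

theorem mem_centerTorsion {G : Type*} [Group G] {n : ℕ} {x : G} :
    x ∈ centerTorsion G n ↔ x ∈ center G ∧ x ^ n = 1 := by
  constructor
  · rintro ⟨y, hy, rfl⟩
    exact ⟨y.2, congrArg Subtype.val hy⟩
  · rintro ⟨hx, h⟩
    exact ⟨⟨x, hx⟩, Subtype.ext h, rfl⟩

theorem exists_commutatorElement_pow_ne_one {G : Type*} [Group G]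
    (hZ : ∀ a b : G, ⁅a, b⁆ ∈ center G) {n : ℕ} (hn : ¬ Monoid.exponent (commutator G) ∣ n) :
    ∃ a b : G, ⁅a, b⁆ ^ n ≠ 1 := by
  by_contra! h
  have hle : commutator G ≤ centerTorsion G n :=
    commutator_le.2 fun a _ b _ => mem_centerTorsion.2 ⟨hZ a b, h a b⟩
  exact hn (Monoid.exponent_dvd_of_forall_pow_eq_one
    fun x => Subtype.ext (mem_centerTorsion.1 (hle x.2)).2)

theorem exists_sq_eq_pow_prime_pow {G : Type*} [Group G] {p e : ℕ} (hp : p.Prime) (he : 1 ≤ e)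
    (he2 : p = 2 → 2 ≤ e) (H : Subgroup G) {c : G} (hc : c ∈ H) (hce : c ^ p ^ e = 1) :
    ∃ w ∈ H, w ^ 2 = c ^ p ^ (e - 1) ∧ w ^ p ^ 2 = 1 := by
  rcases hp.eq_two_or_odd' with rfl | ⟨m, rfl⟩
  · have := he2 rfl
    refine ⟨c ^ 2 ^ (e - 2), H.pow_mem hc _, ?_, ?_⟩
    · rw [← pow_mul, ← pow_succ]
      congr 2
      omega
    · rw [← pow_mul, ← pow_add, Nat.sub_add_cancel this, hce]
  · have h : (c ^ (2 * m + 1) ^ (e - 1)) ^ (2 * m + 1) = 1 := by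
      rw [← pow_mul, ← pow_succ, Nat.sub_add_cancel he, hce]
    refine ⟨(c ^ (2 * m + 1) ^ (e - 1)) ^ (m + 1), H.pow_mem (H.pow_mem hc _) _, ?_, ?_⟩
    · rw [← pow_mul, show (m + 1) * 2 = 2 * m + 1 + 1 by ring, pow_succ, h, one_mul]
    · rw [pow_right_comm, sq, pow_mul, h, one_pow, one_pow]

end

/-- If `G` is a Miller `p`-group with `|[G,G]| > 2`, then `[G,G]` has at least two
cyclic factors of maximal order: the subgroup generated by the `p^(e-1)`-th powers of
elements of `[G,G]` (where `p^e = exp [G,G]`) is not cyclic. -/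
theorem miller_commutator_at_least_two_maximal_cyclic_factors
    (p : ℕ) (hp : p.Prime)
    (G : Type*) [Group G] (hG : IsMiller G) (hpG : IsPGroup p G)
    (hcard : 2 < Nat.card ↥(commutator G))
    (e : ℕ) (he : Monoid.exponent ↥(commutator G) = p ^ e) :
    ¬ IsCyclic ↥(Subgroup.closure
      ((fun x : G => x ^ p ^ (e - 1)) '' (commutator G : Set G))) := by
  have := hG.1
  have hZ := hG.commutatorElement_mem_center
  have hGZ : commutator G ≤ Subgroup.center G := commutator_le_center hZ
  have hexp (c : G) (hc : c ∈ commutator G) : c ^ p ^ e = 1 := by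
    rw [← he]
    exact congrArg Subtype.val (Monoid.pow_exponent_eq_one (⟨c, hc⟩ : commutator G))
  have he1 : 1 ≤ e := by
    by_contra! h
    have hsub : Subsingleton (commutator G) := by
      rw [← Monoid.exp_eq_one_iff, he, Nat.lt_one_iff.1 h, pow_zero]
    have := Nat.card_of_subsingleton (1 : commutator G)
    omega
  have hexp' (c : G) (hc : c ∈ commutator G) : (c ^ p ^ (e - 1)) ^ p = 1 := by
    rw [← pow_mul, ← pow_succ, Nat.sub_add_cancel he1, hexp c hc]
  intro hcyc
  set D := Subgroup.closure ((fun x : G => x ^ p ^ (e - 1)) '' (commutator G : Set G)) with hD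
  have hmemD (c : G) (hc : c ∈ commutator G) : c ^ p ^ (e - 1) ∈ D :=
    Subgroup.subset_closure ⟨c, hc, rfl⟩
  have hDle : D ≤ centerTorsion G p := by
    rw [hD, Subgroup.closure_le]
    rintro _ ⟨c, hc, rfl⟩
    exact mem_centerTorsion.2 ⟨(Subgroup.center G).pow_mem (hGZ hc) _, hexp' c hc⟩
  have hcardD : Nat.card D ∣ p := by
    rw [← IsCyclic.exponent_eq_card]
    exact Monoid.exponent_dvd_of_forall_pow_eq_one
      fun x => Subtype.ext (mem_centerTorsion.1 (hDle x.2)).2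
  have he2 : p = 2 → 2 ≤ e := by
    rintro rfl
    by_contra! h
    obtain rfl : e = 1 := by omega
    have hle : commutator G ≤ D := fun c hc => by simpa using hmemD c hc
    have h1 := Nat.le_of_dvd two_pos hcardD
    have h2 := Subgroup.card_le_of_le hle
    omega
  have hpow (c : G) (hc : c ∈ commutator G) (d : G) (hd : d ∈ commutator G)
      (h : c ^ p ^ (e - 1) ≠ 1) : ∃ s : ℕ, d ^ p ^ (e - 1) = (c ^ p ^ (e - 1)) ^ s := by
    let c' : D := ⟨_, hmemD c hc⟩
    have hc' : c' ≠ 1 := fun hh => h (congrArg Subtype.val hh)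
    have hcard' : Nat.card D = p := by
      refine ((Nat.dvd_prime hp).1 hcardD).resolve_left fun h1 => hc' ?_
      have := (Nat.card_eq_one_iff_unique.1 h1).1
      exact Subsingleton.elim _ _
    have := Fact.mk hp
    obtain ⟨s, hs⟩ := mem_powers_iff_mem_zpowers.2
      (mem_zpowers_of_prime_card (g' := ⟨_, hmemD d hd⟩) hcard' hc')
    exact ⟨s, (congrArg Subtype.val hs).symm⟩
  have hne := exists_commutatorElement_pow_ne_one hZ (n := p ^ (e - 1)) (by
    rw [he, Nat.pow_dvd_pow_iff_le_right hp.one_lt]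
    omega)
  obtain ⟨u, y, j, huy, hu, hker⟩ :=
    exists_adapted_element hp hpG hZ he1 he2 hexp hpow hne
  have huyG := commutatorElement_mem_commutator u y
  obtain ⟨φ, hφ⟩ := exists_mulAut_not_central hp hZ hexp' hpow
    (exists_sq_eq_pow_prime_pow hp he1 he2 _ huyG (hexp _ huyG)) huy hu hker
  exact hφ (hG.apply_mul_inv_mem_center φ y)
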